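/- arXiv:2109.00933 — 2 statements merged into one kernel-verified Lean document; each statement's English description precedes it below -/
import Mathlib

section
/- Let 𝒜 and ℬ be abelian categories with enough projectives and injectives, T : ℬ → 𝒜 a right exact functor, (𝒞₁,𝒞₂) a complete hereditary cotorsion pair in 𝒜 and (𝒟₁,𝒟₂) a complete hereditary cotorsion pair in ℬ. Assume T(D) ∈ 𝒞₁ ∩ 𝒞₂ for every D ∈ 𝒟₁ ∩ 𝒟₂, T(D) ∈ 𝒞₁ for every D ∈ 𝒟₁, and (L_nT)(D) = 0 for every D ∈ 𝒟₁ and every n ≥ 1. Then (𝔅^{𝒞₁}_{𝒟₁}, 𝔅^{𝒞₁∩𝒞₂}_{𝒟₁∩𝒟₂}) is a left Frobenius pair in the comma category (T↓𝒜). -/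
/-!
Formalization of a statement from "Recollements induced by left Frobenius pairs"
(Ma, Sun, Zhu, Hu). Auxiliary definitions (left Frobenius pairs, the classes
`𝒳̂` and `𝔅^𝒳_𝒴`, etc.) are given first; the statement itself is the final theorem.
-/

noncomputable section
namespace Paper
open CategoryTheory CategoryTheory.Limits ZeroObject

universe w₁ w₂ w₃ v v' u u'

section Core
variable {𝒜 : Type u} [Category.{v} 𝒜] [Abelian 𝒜]

/-- `C` is isomorphic to some member of the class `𝒳`. -/
def MemIso (𝒳 : Set 𝒜) (C : 𝒜) : Prop := ∃ X ∈ 𝒳, Nonempty (X ≅ C)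

/-- `C` admits an exact resolution `0 → X_n → ⋯ → X_0 → C → 0` with all `X_i ∈ 𝒳`. -/
def HasResolutionOfLength (𝒳 : Set 𝒜) : ℕ → 𝒜 → Prop
  | 0, C => MemIso 𝒳 C
  | (n+1), C => ∃ S : ShortComplex 𝒜, S.ShortExact ∧ S.X₃ = C ∧ S.X₂ ∈ 𝒳 ∧
      HasResolutionOfLength 𝒳 n S.X₁

/-- The class `𝒳̂` of objects admitting a finite exact resolution by objects of `𝒳`. -/
def Hat (𝒳 : Set 𝒜) : Set 𝒜 := {C | ∃ n, HasResolutionOfLength 𝒳 n C}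

variable [HasExt.{w₁} 𝒜]

/-- `(𝒳, 𝒲)` is a left Frobenius pair in the abelian category `𝒜`:
`𝒳` is closed under extensions, kernels of epimorphisms and direct summands,
`𝒲` is closed under direct summands, `𝒲 ⊆ 𝒳 ∩ 𝒳^⊥`, and every `X ∈ 𝒳` admits a
short exact sequence `0 → X → W → X' → 0` with `W ∈ 𝒲`, `X' ∈ 𝒳`. -/
structure IsLeftFrobeniusPair (𝒳 𝒲 : Set 𝒜) : Prop where
  closed_extensions : ∀ S : ShortComplex 𝒜, S.ShortExact → S.X₁ ∈ 𝒳 → S.X₃ ∈ 𝒳 → S.X₂ ∈ 𝒳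
  closed_kernels_of_epis : ∀ S : ShortComplex 𝒜, S.ShortExact → S.X₂ ∈ 𝒳 → S.X₃ ∈ 𝒳 → S.X₁ ∈ 𝒳
  closed_summands_X : ∀ C A B : 𝒜, C ∈ 𝒳 → Nonempty (C ≅ A ⊞ B) → A ∈ 𝒳
  closed_summands_W : ∀ C A B : 𝒜, C ∈ 𝒲 → Nonempty (C ≅ A ⊞ B) → A ∈ 𝒲
  W_subset_X : 𝒲 ⊆ 𝒳
  W_subset_rightPerp : ∀ W ∈ 𝒲, ∀ X ∈ 𝒳, ∀ i : ℕ, 1 ≤ i → Subsingleton (Abelian.Ext X W i)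
  cogenerator : ∀ X ∈ 𝒳, ∃ S : ShortComplex 𝒜, S.ShortExact ∧ S.X₁ = X ∧ S.X₂ ∈ 𝒲 ∧ S.X₃ ∈ 𝒳

/-- `(𝒳, 𝒲)` is a strong left Frobenius pair: a left Frobenius pair such that moreover
`𝒲 ⊆ ^⊥𝒳` and every `X ∈ 𝒳` admits a short exact sequence `0 → X' → W → X → 0`
with `W ∈ 𝒲`, `X' ∈ 𝒳`. -/
structure IsStrongLeftFrobeniusPair (𝒳 𝒲 : Set 𝒜) extends IsLeftFrobeniusPair 𝒳 𝒲 : Prop where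
  W_subset_leftPerp : ∀ W ∈ 𝒲, ∀ X ∈ 𝒳, ∀ i : ℕ, 1 ≤ i → Subsingleton (Abelian.Ext W X i)
  generator : ∀ X ∈ 𝒳, ∃ S : ShortComplex 𝒜, S.ShortExact ∧ S.X₃ = X ∧ S.X₂ ∈ 𝒲 ∧ S.X₁ ∈ 𝒳

end Core

section CommaDefs
variable {𝒜 : Type u} [Category.{v} 𝒜] [Abelian 𝒜]
  {ℬ : Type u'} [Category.{v'} ℬ] [Abelian ℬ] (T : ℬ ⥤ 𝒜)

/-- The class `𝔅^𝒳_𝒴` in the comma category `(T ↓ 𝒜)`, consisting of the objects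
`(X, Y, φ : T Y ⟶ X)` with `Y ∈ 𝒴`, `φ` a monomorphism and `Coker φ ∈ 𝒳`. -/
def CommaClass (𝒳 : Set 𝒜) (𝒴 : Set ℬ) : Set (Comma T (𝟭 𝒜)) :=
  {Z | Z.left ∈ 𝒴 ∧ Mono Z.hom ∧ MemIso 𝒳 (cokernel Z.hom)}

end CommaDefs

section Cotorsion
variable {𝒜 : Type u} [Category.{v} 𝒜] [Abelian 𝒜] [HasExt.{w₁} 𝒜]

/-- `(𝒳, 𝒴)` is a cotorsion pair: each class is the `Ext¹`-orthogonal of the other. -/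
structure IsCotorsionPair (𝒳 𝒴 : Set 𝒜) : Prop where
  mem_left_iff : ∀ A : 𝒜, A ∈ 𝒳 ↔ ∀ Y ∈ 𝒴, Subsingleton (Abelian.Ext A Y 1)
  mem_right_iff : ∀ A : 𝒜, A ∈ 𝒴 ↔ ∀ X ∈ 𝒳, Subsingleton (Abelian.Ext X A 1)

/-- A complete cotorsion pair. -/
structure IsCompleteCotorsionPair (𝒳 𝒴 : Set 𝒜) extends IsCotorsionPair 𝒳 𝒴 : Prop where
  deres : ∀ A : 𝒜, ∃ S : ShortComplex 𝒜, S.ShortExact ∧ S.X₁ ∈ 𝒴 ∧ S.X₂ ∈ 𝒳 ∧ S.X₃ = A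
  cores : ∀ A : 𝒜, ∃ S : ShortComplex 𝒜, S.ShortExact ∧ S.X₁ = A ∧ S.X₂ ∈ 𝒴 ∧ S.X₃ ∈ 𝒳

/-- A complete hereditary cotorsion pair. -/
structure IsCompleteHereditaryCotorsionPair (𝒳 𝒴 : Set 𝒜)
    extends IsCompleteCotorsionPair 𝒳 𝒴 : Prop where
  hereditary : ∀ X ∈ 𝒳, ∀ Y ∈ 𝒴, ∀ i : ℕ, 1 ≤ i → Subsingleton (Abelian.Ext X Y i)

/-- A projective cotorsion pair: a complete cotorsion pair `(𝒳, 𝒴)` such that `𝒴` is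
thick and `𝒳 ∩ 𝒴` is exactly the class of projective objects. -/
structure IsProjectiveCotorsionPair (𝒳 𝒴 : Set 𝒜)
    extends IsCompleteCotorsionPair 𝒳 𝒴 : Prop where
  thick_summands : ∀ C A B : 𝒜, C ∈ 𝒴 → Nonempty (C ≅ A ⊞ B) → A ∈ 𝒴
  thick_two_of_three₁ : ∀ S : ShortComplex 𝒜, S.ShortExact → S.X₂ ∈ 𝒴 → S.X₃ ∈ 𝒴 → S.X₁ ∈ 𝒴
  thick_two_of_three₂ : ∀ S : ShortComplex 𝒜, S.ShortExact → S.X₁ ∈ 𝒴 → S.X₃ ∈ 𝒴 → S.X₂ ∈ 𝒴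
  thick_two_of_three₃ : ∀ S : ShortComplex 𝒜, S.ShortExact → S.X₁ ∈ 𝒴 → S.X₂ ∈ 𝒴 → S.X₃ ∈ 𝒴
  inter_eq_projectives : ∀ C : 𝒜, (C ∈ 𝒳 ∧ C ∈ 𝒴) ↔ Projective C

end Cotorsion

end Paper

open CategoryTheory CategoryTheory.Limits ZeroObject Paper

universe w₁ w₂ w₃ v v' u u'


namespace Paper

section Ext

open Abelian

variable {C : Type u} [Category.{v} C] [Abelian C] [HasExt.{w₁} C]

lemma subsingleton_ext_left_of_retract {X Y W : C} (r : Retract X Y) {n : ℕ}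
    (h : Subsingleton (Ext Y W n)) : Subsingleton (Ext X W n) :=
  subsingleton_of_forall_eq 0 fun e ↦ by
    have h₀ : (Ext.mk₀ r.r).comp e (zero_add n) = 0 := Subsingleton.elim _ _
    simpa using congr((Ext.mk₀ r.i).comp $h₀ (zero_add n))

lemma subsingleton_ext_right_of_retract {X Y W : C} (r : Retract X Y) {n : ℕ}
    (h : Subsingleton (Ext W Y n)) : Subsingleton (Ext W X n) :=
  subsingleton_of_forall_eq 0 fun e ↦ by
    have h₀ : e.comp (Ext.mk₀ r.i) (add_zero n) = 0 := Subsingleton.elim _ _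
    simpa [Ext.comp_assoc_of_third_deg_zero] using congr(Ext.comp $h₀ (Ext.mk₀ r.r) (add_zero n))

variable {S : ShortComplex C}

lemma subsingleton_ext_X₁_left (hS : S.ShortExact) {W : C} {n m : ℕ} (hm : 1 + n = m)
    (h₂ : Subsingleton (Ext S.X₂ W n)) (h₃ : Subsingleton (Ext S.X₃ W m)) :
    Subsingleton (Ext S.X₁ W n) :=
  subsingleton_of_forall_eq 0 fun e ↦ by
    obtain ⟨x, rfl⟩ := Ext.contravariant_sequence_exact₁ hS W e hm (Subsingleton.elim _ _)
    rw [Subsingleton.elim x 0, Ext.comp_zero]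

lemma subsingleton_ext_X₂_left (hS : S.ShortExact) {W : C} {n : ℕ}
    (h₁ : Subsingleton (Ext S.X₁ W n)) (h₃ : Subsingleton (Ext S.X₃ W n)) :
    Subsingleton (Ext S.X₂ W n) :=
  subsingleton_of_forall_eq 0 fun e ↦ by
    obtain ⟨x, rfl⟩ := Ext.contravariant_sequence_exact₂ hS W e (Subsingleton.elim _ _)
    rw [Subsingleton.elim x 0, Ext.comp_zero]

lemma subsingleton_ext_X₃_left (hS : S.ShortExact) {W : C} {n m : ℕ} (hm : 1 + n = m)
    (h₁ : Subsingleton (Ext S.X₁ W n)) (h₂ : Subsingleton (Ext S.X₂ W m)) :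
    Subsingleton (Ext S.X₃ W m) :=
  subsingleton_of_forall_eq 0 fun e ↦ by
    obtain ⟨x, rfl⟩ := Ext.contravariant_sequence_exact₃ hS W e (Subsingleton.elim _ _) hm
    rw [Subsingleton.elim x 0, Ext.comp_zero]

lemma subsingleton_ext_X₂_right (hS : S.ShortExact) {W : C} {n : ℕ}
    (h₁ : Subsingleton (Ext W S.X₁ n)) (h₃ : Subsingleton (Ext W S.X₃ n)) :
    Subsingleton (Ext W S.X₂ n) :=
  subsingleton_of_forall_eq 0 fun e ↦ by
    obtain ⟨x, rfl⟩ := Ext.covariant_sequence_exact₂ W hS e (Subsingleton.elim _ _)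
    rw [Subsingleton.elim x 0, Ext.zero_comp]

lemma exists_extension_of_subsingleton_ext (hS : S.ShortExact) {W : C}
    (h₃ : Subsingleton (Ext S.X₃ W 1)) (f : S.X₁ ⟶ W) : ∃ g : S.X₂ ⟶ W, S.f ≫ g = f := by
  obtain ⟨x, hx⟩ := Ext.contravariant_sequence_exact₁ hS W (Ext.mk₀ f) rfl (Subsingleton.elim _ _)
  obtain ⟨g, rfl⟩ := Ext.addEquiv₀.symm.surjective x
  exact ⟨g, Ext.addEquiv₀.symm.injective (by simpa [Ext.addEquiv₀] using hx)⟩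

/-- If every morphism from the kernel of an epimorphism `P ⟶ X` with `P` projective extends
to `P`, then the first `Ext` group vanishes. -/
lemma subsingleton_ext_one_of_extension (hS : S.ShortExact) [Projective S.X₂] {W : C}
    (h : ∀ f : S.X₁ ⟶ W, ∃ g : S.X₂ ⟶ W, S.f ≫ g = f) : Subsingleton (Ext S.X₃ W 1) :=
  subsingleton_of_forall_eq 0 fun e ↦ by
    obtain ⟨x, rfl⟩ := Ext.contravariant_sequence_exact₃ hS W e (Ext.eq_zero_of_projective _)
      (add_zero 1)
    obtain ⟨f, rfl⟩ := Ext.addEquiv₀.symm.surjective x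
    obtain ⟨g, rfl⟩ := h f
    change hS.extClass.comp (Ext.mk₀ _) _ = 0
    rw [← Ext.mk₀_comp_mk₀, hS.extClass_comp_assoc]

/-- Dimension shifting along a class of objects with enough projectives. -/
lemma subsingleton_ext_of_subsingleton_ext_one (𝒳 : Set C) (W : C)
    (h𝒳 : ∀ X ∈ 𝒳, ∃ S : ShortComplex C, S.ShortExact ∧ Projective S.X₂ ∧ S.X₁ ∈ 𝒳 ∧ S.X₃ = X)
    (h : ∀ X ∈ 𝒳, Subsingleton (Ext X W 1)) (n : ℕ) :
    ∀ X ∈ 𝒳, Subsingleton (Ext X W (n + 1)) := by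
  induction n with
  | zero => exact h
  | succ n ih =>
    intro X hX
    obtain ⟨S, hS, _, hS₁, rfl⟩ := h𝒳 X hX
    exact subsingleton_ext_X₃_left hS (by lia) (ih _ hS₁) (Ext.subsingleton_of_projective _ _ _)

end Ext

section Cotorsion

variable {C : Type u} [Category.{v} C] [Abelian C] [HasExt.{w₁} C] {𝒳 𝒴 : Set C}

namespace IsCotorsionPair

lemma subsingleton_ext_one (h : IsCotorsionPair 𝒳 𝒴) {X Y : C} (hX : X ∈ 𝒳) (hY : Y ∈ 𝒴) :
    Subsingleton (Abelian.Ext X Y 1) :=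
  (h.mem_left_iff X).1 hX Y hY

lemma left_of_retract (h : IsCotorsionPair 𝒳 𝒴)
    {X X' : C} (r : Retract X X') (hX' : X' ∈ 𝒳) : X ∈ 𝒳 :=
  (h.mem_left_iff _).2 fun _ hY ↦
    subsingleton_ext_left_of_retract r (h.subsingleton_ext_one hX' hY)

lemma right_of_retract (h : IsCotorsionPair 𝒳 𝒴)
    {Y Y' : C} (r : Retract Y Y') (hY' : Y' ∈ 𝒴) : Y ∈ 𝒴 :=
  (h.mem_right_iff _).2 fun _ hX ↦
    subsingleton_ext_right_of_retract r (h.subsingleton_ext_one hX hY')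

lemma left_X₂ (h : IsCotorsionPair 𝒳 𝒴)
    {S : ShortComplex C} (hS : S.ShortExact) (h₁ : S.X₁ ∈ 𝒳) (h₃ : S.X₃ ∈ 𝒳) :
    S.X₂ ∈ 𝒳 :=
  (h.mem_left_iff _).2 fun _ hY ↦ subsingleton_ext_X₂_left hS
    (h.subsingleton_ext_one h₁ hY) (h.subsingleton_ext_one h₃ hY)

lemma right_X₂ (h : IsCotorsionPair 𝒳 𝒴)
    {S : ShortComplex C} (hS : S.ShortExact) (h₁ : S.X₁ ∈ 𝒴) (h₃ : S.X₃ ∈ 𝒴) :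
    S.X₂ ∈ 𝒴 :=
  (h.mem_right_iff _).2 fun _ hX ↦ subsingleton_ext_X₂_right hS
    (h.subsingleton_ext_one hX h₁) (h.subsingleton_ext_one hX h₃)

lemma left_of_projective (h : IsCotorsionPair 𝒳 𝒴) (P : C) [Projective P] : P ∈ 𝒳 :=
  (h.mem_left_iff _).2 fun _ _ ↦ Abelian.Ext.subsingleton_of_projective _ _ _

end IsCotorsionPair

lemma IsCompleteHereditaryCotorsionPair.left_X₁ (h : IsCompleteHereditaryCotorsionPair 𝒳 𝒴)
    {S : ShortComplex C} (hS : S.ShortExact) (h₂ : S.X₂ ∈ 𝒳) (h₃ : S.X₃ ∈ 𝒳) : S.X₁ ∈ 𝒳 :=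
  (h.mem_left_iff _).2 fun Y hY ↦ subsingleton_ext_X₁_left hS rfl
    (h.subsingleton_ext_one h₂ hY) (h.hereditary _ h₃ Y hY 2 one_le_two)

/-- Every object of the left class embeds into the intersection of both classes, with cokernel
in the left class. -/
lemma IsCompleteCotorsionPair.exists_embedding (h : IsCompleteCotorsionPair 𝒳 𝒴)
    {X : C} (hX : X ∈ 𝒳) :
    ∃ (W X' : C) (f : X ⟶ W) (g : W ⟶ X') (w : f ≫ g = 0),
      (ShortComplex.mk f g w).ShortExact ∧ W ∈ 𝒳 ∩ 𝒴 ∧ X' ∈ 𝒳 := by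
  obtain ⟨S, hS, rfl, h₂, h₃⟩ := h.cores X
  exact ⟨S.X₂, S.X₃, S.f, S.g, S.zero, hS, ⟨h.left_X₂ hS hX h₃, h₂⟩, h₃⟩

end Cotorsion

section Snake

variable {C : Type u} [Category.{v} C] [Abelian C] {S₁ S₂ : ShortComplex C}

/-- The snake input given by a morphism of short exact sequences. -/
def snakeInput (φ : S₁ ⟶ S₂) (h₁ : S₁.ShortExact) (h₂ : S₂.ShortExact) :
    ShortComplex.SnakeInput C where
  L₀ := kernel φ
  L₁ := S₁
  L₂ := S₂
  L₃ := .mk (cokernel.map φ.τ₁ φ.τ₂ S₁.f S₂.f φ.comm₁₂)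
    (cokernel.map φ.τ₂ φ.τ₃ S₁.g S₂.g φ.comm₂₃) (by
      rw [← cancel_epi (cokernel.π φ.τ₁)]; simp)
  v₀₁ := kernel.ι φ
  v₁₂ := φ
  v₂₃ :=
    { τ₁ := cokernel.π _
      τ₂ := cokernel.π _
      τ₃ := cokernel.π _ }
  h₀ := kernelIsKernel φ
  h₃ := ShortComplex.isColimitOfIsColimitπ _
    ((isColimitMapCoconeCoforkEquiv' _ _).symm (cokernelIsCokernel φ.τ₁))
    ((isColimitMapCoconeCoforkEquiv' _ _).symm (cokernelIsCokernel φ.τ₂))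
    ((isColimitMapCoconeCoforkEquiv' _ _).symm (cokernelIsCokernel φ.τ₃))
  L₁_exact := h₁.exact
  epi_L₁_g := h₁.epi_g
  L₂_exact := h₂.exact
  mono_L₂_f := h₂.mono_f

lemma shortExact_cokernel (φ : S₁ ⟶ S₂) (h₁ : S₁.ShortExact) (h₂ : S₂.ShortExact)
    [Mono φ.τ₃] : (snakeInput φ h₁ h₂).L₃.ShortExact := by
  have : Mono (snakeInput φ h₁ h₂).v₁₂.τ₃ := inferInstanceAs (Mono φ.τ₃)
  have h₀ : IsZero (snakeInput φ h₁ h₂).L₀.X₃ :=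
    KernelFork.IsLimit.isZero_of_mono (snakeInput φ h₁ h₂).h₀τ₃
  have := h₂.epi_g
  exact
    { exact := (snakeInput φ h₁ h₂).L₃_exact
      mono_f := (snakeInput φ h₁ h₂).L₂'_exact.mono_g (h₀.eq_of_src _ _)
      epi_g := by
        have : Epi (cokernel.π φ.τ₂ ≫ (snakeInput φ h₁ h₂).L₃.g) := by
          have : Epi (S₂.g ≫ cokernel.π φ.τ₃) := inferInstance
          simpa [snakeInput] using this
        exact epi_of_epi (cokernel.π φ.τ₂) _ }

lemma mono_τ₃_of_mono_cokernel_map (φ : S₁ ⟶ S₂) (h₁ : S₁.ShortExact) (h₂ : S₂.ShortExact)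
    [Mono φ.τ₂] [Mono (cokernel.map φ.τ₁ φ.τ₂ S₁.f S₂.f φ.comm₁₂)] : Mono φ.τ₃ := by
  have : Mono (snakeInput φ h₁ h₂).v₁₂.τ₂ := inferInstanceAs (Mono φ.τ₂)
  have h₀ : IsZero (snakeInput φ h₁ h₂).L₀.X₂ :=
    KernelFork.IsLimit.isZero_of_mono (snakeInput φ h₁ h₂).h₀τ₂
  have : Mono (snakeInput φ h₁ h₂).L₃.f :=
    inferInstanceAs (Mono (cokernel.map φ.τ₁ φ.τ₂ S₁.f S₂.f φ.comm₁₂))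
  have := (snakeInput φ h₁ h₂).mono_δ h₀
  have hδ : (snakeInput φ h₁ h₂).δ = 0 := by
    rw [← cancel_mono (snakeInput φ h₁ h₂).L₃.f, (snakeInput φ h₁ h₂).δ_L₃_f, zero_comp]
  have h₃ : IsZero (snakeInput φ h₁ h₂).L₀.X₃ := by
    rw [IsZero.iff_id_eq_zero, ← cancel_mono (snakeInput φ h₁ h₂).δ, hδ, comp_zero, comp_zero]
  exact (snakeInput φ h₁ h₂).exact_C₃_up.mono_g (h₃.eq_of_src _ _)

/-- The third terms of short exact sequences with isomorphic monomorphisms are isomorphic. -/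
def isoX₃OfShortExact (h₁ : S₁.ShortExact) (h₂ : S₂.ShortExact) (e₁ : S₁.X₁ ≅ S₂.X₁)
    (e₂ : S₁.X₂ ≅ S₂.X₂) (w : S₁.f ≫ e₂.hom = e₁.hom ≫ S₂.f) : S₁.X₃ ≅ S₂.X₃ :=
  (h₁.gIsCokernel.coconePointUniqueUpToIso (cokernelIsCokernel S₁.f)) ≪≫
    cokernel.mapIso _ _ e₁ e₂ w ≪≫
    (cokernelIsCokernel S₂.f).coconePointUniqueUpToIso h₂.gIsCokernel

end Snake

section RightExact

variable {𝒜 : Type u} [Category.{v} 𝒜] [Abelian 𝒜]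
  {ℬ : Type u'} [Category.{v'} ℬ] [Abelian ℬ]
  (T : ℬ ⥤ 𝒜) [T.Additive] [PreservesFiniteColimits T]

/-- A right exact functor preserves short exact sequences whose third term is
acyclic for its first left derived functor. -/
lemma shortExact_map_of_isZero_leftDerived [EnoughProjectives ℬ] {S : ShortComplex ℬ}
    (hS : S.ShortExact) (h : IsZero ((T.leftDerived 1).obj S.X₃)) : (S.map T).ShortExact := by
  have := hS.epi_g
  have := hS.mono_f
  let P := ProjectiveResolution.of S.X₃
  have hT : (ShortComplex.mk (T.map (P.complex.d 2 1)) (T.map (P.complex.d 1 0))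
      (by simp [← T.map_comp])).Exact := by
    have h₁ : ((T.mapHomologicalComplex _).obj P.complex).ExactAt 1 := by
      rw [HomologicalComplex.exactAt_iff_isZero_homology]
      exact h.of_iso (P.isoLeftDerivedObj T 1).symm
    exact (HomologicalComplex.exactAt_iff' _ 2 1 0 (by simp) (by simp)).1 h₁
  let p : P.complex.X 0 ⟶ S.X₃ := P.π.f 0
  have : Epi p := inferInstanceAs (Epi (P.π.f 0))
  let f₀ : P.complex.X 0 ⟶ S.X₂ := Projective.factorThru p S.g
  have hf₀ : f₀ ≫ S.g = p := Projective.factorThru_comp _ _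
  have hdp : P.complex.d 1 0 ≫ p = 0 := P.complex_d_comp_π_f_zero
  have hdf : (P.complex.d 1 0 ≫ f₀) ≫ S.g = 0 := by rw [Category.assoc, hf₀, hdp]
  let f₁ : P.complex.X 1 ⟶ S.X₁ := hS.exact.lift _ hdf
  have hf₁ : f₁ ≫ S.f = P.complex.d 1 0 ≫ f₀ := hS.exact.lift_f _ _
  have hdf₁ : P.complex.d 2 1 ≫ f₁ = 0 := by
    rw [← cancel_mono S.f, Category.assoc, hf₁]; simp
  let E : ShortComplex ℬ := .mk (biprod.lift f₁ (-P.complex.d 1 0)) (biprod.desc S.f f₀)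
    (by simp [hf₁])
  have hE : E.Exact := by
    rw [ShortComplex.exact_iff_exact_up_to_refinements]
    intro A x hx
    have hx' : (x ≫ biprod.fst) ≫ S.f + (x ≫ biprod.snd) ≫ f₀ = 0 := by
      simpa [E, biprod.desc_eq] using hx
    have hxp : (x ≫ biprod.snd) ≫ p = 0 := by
      simpa [hf₀] using congr($hx' ≫ S.g)
    obtain ⟨A', π, _, y, hy⟩ := P.exact₀.exact_up_to_refinements (x ≫ biprod.snd) hxp
    refine ⟨A', π, inferInstance, -y, ?_⟩
    dsimp [E] at hy ⊢
    ext
    · rw [← cancel_mono S.f]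
      have : π ≫ x ≫ biprod.snd ≫ f₀ = y ≫ P.complex.d 1 0 ≫ f₀ := by
        simpa using congr($hy ≫ f₀)
      have hx'' := congr(π ≫ $hx')
      simp only [Preadditive.comp_add, Category.assoc, comp_zero, this] at hx''
      simpa [hf₁] using eq_neg_of_add_eq_zero_left hx''
    · simpa using hy
  have : Epi E.g := by
    rw [epi_iff_surjective_up_to_refinements]
    intro A x
    obtain ⟨A', π, _, y, hy⟩ := surjective_up_to_refinements_of_epi p (x ≫ S.g)
    have hz : (π ≫ x - y ≫ f₀) ≫ S.g = 0 := by
      simp [Preadditive.sub_comp, hf₀, hy]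
    exact ⟨A', π, inferInstance, biprod.lift (hS.exact.lift _ hz) y, by simp [E]⟩
  have hTE := hE.map_of_epi_of_preservesCokernel T this inferInstance
  have hmono : Mono (T.map S.f) := by
    rw [Preadditive.mono_iff_cancel_zero]
    intro A x hx
    obtain ⟨A', π, _, (y : A' ⟶ T.obj (P.complex.X 1)), hy⟩ :=
      hTE.exact_up_to_refinements (x ≫ T.map biprod.inl) (by
        change (x ≫ T.map biprod.inl) ≫ T.map (biprod.desc S.f f₀) = 0
        rw [Category.assoc, ← T.map_comp, biprod.inl_desc, hx])
    replace hy : π ≫ x ≫ T.map biprod.inl =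
      y ≫ T.map (biprod.lift f₁ (-P.complex.d 1 0)) := hy
    have hy₁ : π ≫ x = y ≫ T.map f₁ := by
      have := congr($hy ≫ T.map biprod.fst)
      simp only [Category.assoc, ← T.map_comp] at this
      simpa using this
    have hy₂ : y ≫ T.map (P.complex.d 1 0) = 0 := by
      have := congr($hy ≫ T.map biprod.snd)
      simp only [Category.assoc, ← T.map_comp] at this
      simpa using this
    obtain ⟨A'', π', _, (z : A'' ⟶ T.obj (P.complex.X 2)), hz⟩ :=
      hT.exact_up_to_refinements y hy₂
    replace hz : π' ≫ y = z ≫ T.map (P.complex.d 2 1) := hz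
    rw [← cancel_epi π, ← cancel_epi π', hy₁, reassoc_of% hz, ← T.map_comp, hdf₁]
    simp
  exact { exact := hS.exact.map_of_epi_of_preservesCokernel T ‹_› inferInstance
          mono_f := hmono
          epi_g := inferInstanceAs (Epi (T.map S.g)) }

end RightExact

section Comma

variable {𝒜 : Type u} [Category.{v} 𝒜] {ℬ : Type u'} [Category.{v'} ℬ] {T : ℬ ⥤ 𝒜}
  {X Y : Comma T (𝟭 𝒜)}

lemma mono_of_mono_left_right (f : X ⟶ Y) [Mono f.left] [Mono f.right] : Mono f where
  right_cancellation g h w := by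
    ext
    · rw [← cancel_mono f.left]; exact congr(($w).left)
    · rw [← cancel_mono f.right]; exact congr(($w).right)

lemma epi_of_epi_left_right (f : X ⟶ Y) [Epi f.left] [Epi f.right] : Epi f where
  left_cancellation g h w := by
    ext
    · rw [← cancel_epi f.left]; exact congr(($w).left)
    · rw [← cancel_epi f.right]; exact congr(($w).right)

end Comma

section CommaLimits

lemma shortExact_of_mono {C : Type u} [Category.{v} C] [Abelian C] {X Y : C} (f : X ⟶ Y)
    (h : Mono f) : (ShortComplex.mk f (cokernel.π f) (cokernel.condition f)).ShortExact where
  exact := ShortComplex.exact_cokernel f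

variable {𝒜 : Type u} [Category.{v} 𝒜] [Abelian 𝒜]
  {ℬ : Type u'} [Category.{v'} ℬ] [Abelian ℬ] (T : ℬ ⥤ 𝒜)

instance : PreservesFiniteLimits (Comma.fst T (𝟭 𝒜)) where
  preservesFiniteLimits _ _ _ :=
    { preservesLimit := preservesLimit_of_preserves_limit_cone
        (Comma.coneOfPreservesIsLimit _ (limit.isLimit _) (limit.isLimit _)) (limit.isLimit _) }

instance : PreservesFiniteLimits (Comma.snd T (𝟭 𝒜)) where
  preservesFiniteLimits _ _ _ :=
    { preservesLimit := preservesLimit_of_preserves_limit_cone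
        (Comma.coneOfPreservesIsLimit _ (limit.isLimit _) (limit.isLimit _)) (limit.isLimit _) }

instance [PreservesFiniteColimits T] : PreservesFiniteColimits (Comma.fst T (𝟭 𝒜)) where
  preservesFiniteColimits _ _ _ := inferInstance

instance [PreservesFiniteColimits T] : PreservesFiniteColimits (Comma.snd T (𝟭 𝒜)) where
  preservesFiniteColimits _ _ _ := inferInstance

end CommaLimits

section CommaAbelian

variable {𝒜 : Type u} [Category.{v} 𝒜] [Abelian 𝒜]
  {ℬ : Type u'} [Category.{v'} ℬ] [Abelian ℬ] {T : ℬ ⥤ 𝒜} [Abelian (Comma T (𝟭 𝒜))]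

/-- The short complex of left components of a short complex in a comma category. -/
abbrev leftRow (S : ShortComplex (Comma T (𝟭 𝒜))) : ShortComplex ℬ :=
  .mk S.f.left S.g.left (S.map (Comma.fst T (𝟭 𝒜))).zero

/-- The short complex of right components of a short complex in a comma category. -/
abbrev rightRow (S : ShortComplex (Comma T (𝟭 𝒜))) : ShortComplex 𝒜 :=
  .mk S.f.right S.g.right (S.map (Comma.snd T (𝟭 𝒜))).zero

/-- The structure morphisms of a short complex in a comma category. -/
def homRow [T.PreservesZeroMorphisms] (S : ShortComplex (Comma T (𝟭 𝒜))) :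
    (leftRow S).map T ⟶ rightRow S where
  τ₁ := S.X₁.hom
  τ₂ := S.X₂.hom
  τ₃ := S.X₃.hom
  comm₁₂ := S.f.w.symm
  comm₂₃ := S.g.w.symm

variable [PreservesFiniteColimits T] {S : ShortComplex (Comma T (𝟭 𝒜))}

lemma shortExact_leftRow (hS : S.ShortExact) : (leftRow S).ShortExact :=
  hS.map_of_exact (Comma.fst T (𝟭 𝒜))

lemma shortExact_rightRow (hS : S.ShortExact) : (rightRow S).ShortExact :=
  hS.map_of_exact (Comma.snd T (𝟭 𝒜))

lemma exists_comma_extension [T.PreservesZeroMorphisms] [HasExt.{w₁} 𝒜] [HasExt.{w₂} ℬ]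
    (hS : S.ShortExact) {W : Comma T (𝟭 𝒜)} (hl : Subsingleton (Abelian.Ext S.X₃.left W.left 1))
    (hr : Subsingleton (Abelian.Ext S.X₃.right W.right 1)) (hm : Mono S.X₃.hom)
    (hc : Subsingleton (Abelian.Ext (cokernel S.X₃.hom) W.right 1)) (f : S.X₁ ⟶ W) :
    ∃ g : S.X₂ ⟶ W, S.f ≫ g = f := by
  obtain ⟨(l : S.X₂.left ⟶ W.left), hl : S.f.left ≫ l = f.left⟩ :=
    exists_extension_of_subsingleton_ext (W := W.left) (shortExact_leftRow hS) hl f.left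
  obtain ⟨(h : S.X₂.right ⟶ W.right), hh : S.f.right ≫ h = f.right⟩ :=
    exists_extension_of_subsingleton_ext (W := W.right) (shortExact_rightRow hS) hr f.right
  have := (shortExact_leftRow hS).epi_g
  have hTe := (shortExact_leftRow hS).exact.map_of_epi_of_preservesCokernel T this inferInstance
  have : Epi ((leftRow S).map T).g := inferInstanceAs (Epi (T.map (leftRow S).g))
  let w : T.obj W.left ⟶ W.right := W.hom
  let x : T.obj S.X₂.left ⟶ S.X₂.right := S.X₂.hom
  have hδ : T.map S.f.left ≫ (x ≫ h - T.map l ≫ w) = 0 := by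
    have h₁ : T.map S.f.left ≫ x = S.X₁.hom ≫ S.f.right := S.f.w
    have h₂ : T.map f.left ≫ w = S.X₁.hom ≫ f.right := f.w
    rw [Preadditive.comp_sub, reassoc_of% h₁, hh, ← T.map_comp_assoc, hl, h₂, sub_self]
  obtain ⟨(δ : T.obj S.X₃.left ⟶ W.right), hδ' : T.map S.g.left ≫ δ = _⟩ :=
    CokernelCofork.IsColimit.desc' hTe.gIsCokernel _ hδ
  obtain ⟨(ε : S.X₃.right ⟶ W.right), hε : S.X₃.hom ≫ ε = δ⟩ :=
    exists_extension_of_subsingleton_ext (shortExact_of_mono _ hm) hc δ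
  have hg : T.map S.g.left ≫ S.X₃.hom = x ≫ S.g.right := S.g.w
  have hfg : S.f.right ≫ S.g.right = 0 := (rightRow S).zero
  refine ⟨⟨l, h - S.g.right ≫ ε, ?_⟩, ?_⟩
  · change T.map l ≫ w = x ≫ (h - S.g.right ≫ ε)
    rw [Preadditive.comp_sub, ← reassoc_of% hg, hε, hδ', sub_sub_cancel]
  · ext
    · exact hl
    · change S.f.right ≫ (h - S.g.right ≫ ε) = f.right
      rw [Preadditive.comp_sub, reassoc_of% hfg, hh, zero_comp, sub_zero]

end CommaAbelian

section CommaBiprod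

variable {𝒜 : Type u} [Category.{v} 𝒜] [Abelian 𝒜]
  {ℬ : Type u'} [Category.{v'} ℬ] (T : ℬ ⥤ 𝒜)

/-- The object `(T B ⊞ A, B, inl)` of the comma category. -/
def commaBiprod (B : ℬ) (A : 𝒜) : Comma T (𝟭 𝒜) where
  left := B
  right := T.obj B ⊞ A
  hom := biprod.inl

lemma shortExact_biprod (X Y : 𝒜) :
    (ShortComplex.mk (biprod.inl : X ⟶ X ⊞ Y) biprod.snd (by simp)).ShortExact :=
  (ShortComplex.Splitting.ofHasBinaryBiproduct X Y).shortExact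

lemma commaBiprod_mem {𝒳 : Set 𝒜} {𝒴 : Set ℬ} {A : 𝒜} {B : ℬ} (hA : A ∈ 𝒳) (hB : B ∈ 𝒴) :
    commaBiprod T B A ∈ CommaClass T 𝒳 𝒴 :=
  ⟨hB, inferInstanceAs (Mono biprod.inl), A, hA,
    ⟨(shortExact_biprod (T.obj B) A).gIsCokernel.coconePointUniqueUpToIso
      (colimit.isColimit (parallelPair (commaBiprod T B A).hom 0))⟩⟩

variable {T}

lemma exists_projective_comma [Abelian ℬ] [EnoughProjectives 𝒜] [EnoughProjectives ℬ]
    [Abelian (Comma T (𝟭 𝒜))] [PreservesFiniteColimits T] (Z : Comma T (𝟭 𝒜)) :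
    ∃ (Q : ℬ) (P : 𝒜) (p : commaBiprod T Q P ⟶ Z), Projective Q ∧ Projective P ∧
      Projective (commaBiprod T Q P) ∧ Epi p := by
  refine ⟨Projective.over Z.left, Projective.over Z.right,
    ⟨Projective.π Z.left, biprod.desc (T.map (Projective.π Z.left) ≫ Z.hom) (Projective.π Z.right),
      (biprod.inl_desc _ _).symm⟩, inferInstance, inferInstance, ⟨fun {E X} f e _ ↦ ?_⟩, ?_⟩
  · have : Epi e.left := inferInstanceAs (Epi ((Comma.fst T (𝟭 𝒜)).map e))
    have : Epi e.right := inferInstanceAs (Epi ((Comma.snd T (𝟭 𝒜)).map e))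
    obtain ⟨l, hl⟩ : ∃ l, l ≫ e.left = f.left :=
      Projective.factors (P := Projective.over Z.left) _ _
    obtain ⟨r, hr⟩ : ∃ r, r ≫ e.right = biprod.inr ≫ f.right :=
      Projective.factors (P := Projective.over Z.right) _ _
    refine ⟨⟨l, biprod.desc (T.map l ≫ E.hom) r, (biprod.inl_desc _ _).symm⟩, ?_⟩
    ext
    · exact hl
    · have hw : T.map f.left ≫ X.hom = biprod.inl ≫ f.right := f.w
      have he : T.map e.left ≫ X.hom = E.hom ≫ e.right := e.w
      apply biprod.hom_ext'
      · change biprod.inl ≫ biprod.desc (T.map l ≫ E.hom) r ≫ e.right = _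
        rw [biprod.inl_desc_assoc, Category.assoc, ← he, ← hw, ← hl, T.map_comp_assoc]
      · change biprod.inr ≫ biprod.desc (T.map l ≫ E.hom) r ≫ e.right = _
        rw [biprod.inr_desc_assoc, hr]
  · let z : T.obj Z.left ⟶ Z.right := Z.hom
    let p : commaBiprod T (Projective.over Z.left) (Projective.over Z.right) ⟶ Z :=
      ⟨Projective.π Z.left, biprod.desc (T.map (Projective.π Z.left) ≫ z) (Projective.π Z.right),
        (biprod.inl_desc _ _).symm⟩
    have : Epi p.left := inferInstanceAs (Epi (Projective.π Z.left))
    have : Epi p.right := by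
      have : Epi (biprod.inr ≫ biprod.desc (T.map (Projective.π Z.left) ≫ z)
          (Projective.π Z.right)) := by
        rw [biprod.inr_desc]; infer_instance
      exact epi_of_epi biprod.inr
        (biprod.desc (T.map (Projective.π Z.left) ≫ z) (Projective.π Z.right))
    exact epi_of_epi_left_right p

end CommaBiprod

section CommaClass

lemma MemIso.mem {𝒜 : Type u} [Category.{v} 𝒜] {𝒳 : Set 𝒜}
    (h𝒳 : ∀ {X X' : 𝒜}, Retract X X' → X' ∈ 𝒳 → X ∈ 𝒳) {A : 𝒜}
    (h : MemIso 𝒳 A) : A ∈ 𝒳 := by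
  obtain ⟨X, hX, ⟨e⟩⟩ := h
  exact h𝒳 (Retract.ofIso e.symm) hX

/-- An object isomorphic to a direct summand is a retract. -/
def retractOfIsoBiprod {C : Type u} [Category.{v} C] [Abelian C] {X Y Z : C} (e : X ≅ Y ⊞ Z) :
    Retract Y X where
  i := biprod.inl ≫ e.inv
  r := e.hom ≫ biprod.fst

variable {𝒜 : Type u} [Category.{v} 𝒜] [Abelian 𝒜]
  {ℬ : Type u'} [Category.{v'} ℬ] {T : ℬ ⥤ 𝒜}

lemma commaClass_of_retract {𝒳 : Set 𝒜} {𝒴 : Set ℬ}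
    (h𝒳 : ∀ {X X' : 𝒜}, Retract X X' → X' ∈ 𝒳 → X ∈ 𝒳)
    (h𝒴 : ∀ {Y Y' : ℬ}, Retract Y Y' → Y' ∈ 𝒴 → Y ∈ 𝒴)
    {Z Z' : Comma T (𝟭 𝒜)} (r : Retract Z Z') (hZ' : Z' ∈ CommaClass T 𝒳 𝒴) :
    Z ∈ CommaClass T 𝒳 𝒴 := by
  obtain ⟨hl, _, hc⟩ := hZ'
  have hi : r.i.left ≫ r.r.left = 𝟙 _ := congr(($r.retract).left)
  have hi' : r.i.right ≫ r.r.right = 𝟙 _ := congr(($r.retract).right)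
  have : Mono (T.map r.i.left ≫ Z'.hom) := by
    have : IsSplitMono (T.map r.i.left) := ⟨⟨T.map r.r.left, by rw [← T.map_comp, hi, T.map_id]⟩⟩
    infer_instance
  have : Mono (Z.hom ≫ r.i.right) := by
    rw [show Z.hom ≫ r.i.right = T.map r.i.left ≫ Z'.hom from r.i.w.symm]
    infer_instance
  let ρ : Retract (cokernel Z.hom) (cokernel Z'.hom) :=
    { i := cokernel.map _ _ (T.map r.i.left) r.i.right r.i.w.symm
      r := cokernel.map _ _ (T.map r.r.left) r.r.right r.r.w.symm
      retract := by
        rw [← cancel_epi (cokernel.π _)]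
        simp [reassoc_of% hi'] }
  exact ⟨h𝒴 (r.map (Comma.fst T (𝟭 𝒜))) hl, mono_of_mono _ r.i.right, _, h𝒳 ρ (hc.mem h𝒳),
    ⟨Iso.refl _⟩⟩

variable [Abelian ℬ] [Abelian (Comma T (𝟭 𝒜))]
  [T.PreservesZeroMorphisms] [PreservesFiniteColimits T]
  [HasExt.{w₁} 𝒜] [HasExt.{w₂} ℬ] {𝒞₁ 𝒞₂ : Set 𝒜} {𝒟₁ 𝒟₂ : Set ℬ}
  {S : ShortComplex (Comma T (𝟭 𝒜))}

lemma commaClass_extension (hC : IsCotorsionPair 𝒞₁ 𝒞₂) (hD : IsCotorsionPair 𝒟₁ 𝒟₂)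
    (hT : ∀ S : ShortComplex ℬ, S.ShortExact → S.X₃ ∈ 𝒟₁ → (S.map T).ShortExact)
    (hS : S.ShortExact) (h₁ : S.X₁ ∈ CommaClass T 𝒞₁ 𝒟₁) (h₃ : S.X₃ ∈ CommaClass T 𝒞₁ 𝒟₁) :
    S.X₂ ∈ CommaClass T 𝒞₁ 𝒟₁ := by
  obtain ⟨hl₁, hm₁, hc₁⟩ := h₁
  obtain ⟨hl₃, hm₃, hc₃⟩ := h₃
  have hl := shortExact_leftRow hS
  have hr := shortExact_rightRow hS
  have hTl := hT _ hl hl₃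
  have := hTl.mono_f
  have := hr.mono_f
  have : Mono (homRow S).τ₁ := hm₁
  have : Mono (homRow S).τ₃ := hm₃
  have hc := shortExact_cokernel (homRow S) hTl hr
  exact ⟨hD.left_X₂ hl hl₁ hl₃,
    ShortComplex.mono_τ₂_of_exact_of_mono (homRow S) hTl.exact, _,
    hC.left_X₂ hc (hc₁.mem hC.left_of_retract) (hc₃.mem hC.left_of_retract), ⟨Iso.refl _⟩⟩

lemma commaClass_kernel (hC : IsCompleteHereditaryCotorsionPair 𝒞₁ 𝒞₂)
    (hD : IsCompleteHereditaryCotorsionPair 𝒟₁ 𝒟₂)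
    (hT : ∀ S : ShortComplex ℬ, S.ShortExact → S.X₃ ∈ 𝒟₁ → (S.map T).ShortExact)
    (hS : S.ShortExact) (h₂ : S.X₂ ∈ CommaClass T 𝒞₁ 𝒟₁) (h₃ : S.X₃ ∈ CommaClass T 𝒞₁ 𝒟₁) :
    S.X₁ ∈ CommaClass T 𝒞₁ 𝒟₁ := by
  obtain ⟨hl₂, hm₂, hc₂⟩ := h₂
  obtain ⟨hl₃, hm₃, hc₃⟩ := h₃
  have hl := shortExact_leftRow hS
  have hr := shortExact_rightRow hS
  have hTl := hT _ hl hl₃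
  have : Mono (homRow S).τ₂ := hm₂
  have : Mono (homRow S).τ₃ := hm₃
  have := hTl.mono_f
  have : Mono ((homRow S).τ₁ ≫ (rightRow S).f) := by
    rw [(homRow S).comm₁₂]
    infer_instance
  have hc := shortExact_cokernel (homRow S) hTl hr
  exact ⟨hD.left_X₁ hl hl₂ hl₃, mono_of_mono (homRow S).τ₁ (rightRow S).f, _,
    hC.left_X₁ hc (hc₂.mem hC.left_of_retract) (hc₃.mem hC.left_of_retract), ⟨Iso.refl _⟩⟩

lemma commaClass_exists_projective [EnoughProjectives 𝒜] [EnoughProjectives ℬ]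
    (hC : IsCompleteHereditaryCotorsionPair 𝒞₁ 𝒞₂) (hD : IsCompleteHereditaryCotorsionPair 𝒟₁ 𝒟₂)
    (hT : ∀ S : ShortComplex ℬ, S.ShortExact → S.X₃ ∈ 𝒟₁ → (S.map T).ShortExact)
    (X : Comma T (𝟭 𝒜)) (hX : X ∈ CommaClass T 𝒞₁ 𝒟₁) :
    ∃ S : ShortComplex (Comma T (𝟭 𝒜)), S.ShortExact ∧ Projective S.X₂ ∧
      S.X₁ ∈ CommaClass T 𝒞₁ 𝒟₁ ∧ S.X₃ = X := by
  obtain ⟨Q, P, p, _, _, hQP, _⟩ := exists_projective_comma X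
  have hS : (ShortComplex.mk (kernel.ι p) p (kernel.condition p)).ShortExact :=
    { exact := ShortComplex.exact_kernel p }
  exact ⟨_, hS, hQP, commaClass_kernel hC hD hT hS
    (commaBiprod_mem T (hC.left_of_projective P) (hD.left_of_projective Q)) hX, rfl⟩

lemma commaClass_ext_one [HasExt.{w₃} (Comma T (𝟭 𝒜))]
    [EnoughProjectives 𝒜] [EnoughProjectives ℬ]
    (hC : IsCompleteHereditaryCotorsionPair 𝒞₁ 𝒞₂) (hD : IsCompleteHereditaryCotorsionPair 𝒟₁ 𝒟₂)
    (hT : ∀ S : ShortComplex ℬ, S.ShortExact → S.X₃ ∈ 𝒟₁ → (S.map T).ShortExact)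
    (hT₁ : ∀ D ∈ 𝒟₁ ∩ 𝒟₂, T.obj D ∈ 𝒞₁ ∩ 𝒞₂) (hT₂ : ∀ D ∈ 𝒟₁, T.obj D ∈ 𝒞₁)
    {W : Comma T (𝟭 𝒜)} (hW : W ∈ CommaClass T (𝒞₁ ∩ 𝒞₂) (𝒟₁ ∩ 𝒟₂))
    (X : Comma T (𝟭 𝒜)) (hX : X ∈ CommaClass T 𝒞₁ 𝒟₁) : Subsingleton (Abelian.Ext X W 1) := by
  obtain ⟨S, hS, _, -, rfl⟩ := commaClass_exists_projective hC hD hT X hX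
  obtain ⟨hXl, hXm, hXc⟩ := hX
  obtain ⟨hWl, hWm, V, hV, ⟨e⟩⟩ := hW
  have hXc' := hXc.mem hC.left_of_retract
  have hXr : S.X₃.right ∈ 𝒞₁ := hC.left_X₂ (shortExact_of_mono _ hXm) (hT₂ _ hXl) hXc'
  have hWr : W.right ∈ 𝒞₂ := hC.right_X₂ (shortExact_of_mono _ hWm) (hT₁ _ hWl).2
    (hC.right_of_retract (Retract.ofIso e.symm) hV.2)
  exact subsingleton_ext_one_of_extension hS (exists_comma_extension hS
    (hD.subsingleton_ext_one hXl hWl.2) (hC.subsingleton_ext_one hXr hWr) hXm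
    (hC.subsingleton_ext_one hXc' hWr))

lemma commaClass_cogenerator (hC : IsCompleteCotorsionPair 𝒞₁ 𝒞₂)
    (hD : IsCompleteCotorsionPair 𝒟₁ 𝒟₂)
    (hT : ∀ S : ShortComplex ℬ, S.ShortExact → S.X₃ ∈ 𝒟₁ → (S.map T).ShortExact)
    (hT₁ : ∀ D ∈ 𝒟₁ ∩ 𝒟₂, T.obj D ∈ 𝒞₁ ∩ 𝒞₂)
    (Z : Comma T (𝟭 𝒜)) (hZ : Z ∈ CommaClass T 𝒞₁ 𝒟₁) :
    ∃ S : ShortComplex (Comma T (𝟭 𝒜)), S.ShortExact ∧ S.X₁ = Z ∧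
      S.X₂ ∈ CommaClass T (𝒞₁ ∩ 𝒞₂) (𝒟₁ ∩ 𝒟₂) ∧ S.X₃ ∈ CommaClass T 𝒞₁ 𝒟₁ := by
  obtain ⟨hZl, hZm, hZc⟩ := hZ
  have hZc' := hZc.mem hC.left_of_retract
  obtain ⟨D, D', i, p, hip, hiS, hD₁, hD'⟩ := hD.exists_embedding hZl
  obtain ⟨U, U', j, q, hjq, hjS, hU, hU'⟩ := hC.exists_embedding hZc'
  have := hiS.mono_f
  have := hjS.mono_f
  have : Mono (T.map i) := (hT _ hiS hD').mono_f
  let z : T.obj Z.left ⟶ Z.right := Z.hom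
  have : Mono z := hZm
  have hZS : (ShortComplex.mk z (cokernel.π z) (cokernel.condition z)).ShortExact :=
    shortExact_of_mono z hZm
  obtain ⟨a : Z.right ⟶ T.obj D, ha : z ≫ a = T.map i⟩ :=
    exists_extension_of_subsingleton_ext hZS
      (hC.subsingleton_ext_one hZc' (hT₁ D hD₁).2) (T.map i)
  let fr : Z.right ⟶ T.obj D ⊞ U := biprod.lift a (cokernel.π z ≫ j)
  have hfr : z ≫ fr = T.map i ≫ biprod.inl := by
    ext <;> simp [fr, ha]
  let f : Z ⟶ commaBiprod T D U := ⟨i, fr, hfr.symm⟩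
  have : Mono f.left := ‹Mono i›
  have : Mono f.right := by
    change Mono fr
    rw [Preadditive.mono_iff_cancel_zero]
    intro A g hg
    have hg₁ : g ≫ a = 0 := by simpa [fr] using congr($hg ≫ biprod.fst)
    have hg₂ : g ≫ cokernel.π z = 0 := by
      rw [← cancel_mono j]
      simpa [fr] using congr($hg ≫ biprod.snd)
    obtain ⟨k, rfl⟩ : ∃ k, k ≫ z = g := ⟨_, hZS.exact.lift_f g hg₂⟩
    have : k = 0 := by rw [← cancel_mono (T.map i), ← ha, ← Category.assoc, hg₁, zero_comp]
    rw [this, zero_comp]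
  have := mono_of_mono_left_right f
  let S : ShortComplex (Comma T (𝟭 𝒜)) := .mk f (cokernel.π f) (cokernel.condition f)
  have hS : S.ShortExact := shortExact_of_mono f this
  have hl : (leftRow S).ShortExact := shortExact_leftRow hS
  have hr : (rightRow S).ShortExact := shortExact_rightRow hS
  let eD : S.X₃.left ≅ D' := isoX₃OfShortExact hl hiS (Iso.refl _) (Iso.refl _) (by
    change i ≫ 𝟙 _ = 𝟙 _ ≫ i
    simp)
  have hl₃ : S.X₃.left ∈ 𝒟₁ := hD.left_of_retract (Retract.ofIso eD) hD'
  have hTl := hT _ hl hl₃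
  have hm₂ : Mono (homRow S).τ₂ := inferInstanceAs (Mono (biprod.inl : T.obj D ⟶ T.obj D ⊞ U))
  let κ : cokernel z ⟶ cokernel (biprod.inl : T.obj D ⟶ T.obj D ⊞ U) :=
    cokernel.map _ _ (T.map i) fr hfr
  let eU : cokernel (biprod.inl : T.obj D ⟶ T.obj D ⊞ U) ≅ U :=
    (cokernelIsCokernel _).coconePointUniqueUpToIso (shortExact_biprod (T.obj D) U).gIsCokernel
  have heU : cokernel.π biprod.inl ≫ eU.hom = biprod.snd :=
    (cokernelIsCokernel _).comp_coconePointUniqueUpToIso_hom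
      (shortExact_biprod (T.obj D) U).gIsCokernel WalkingParallelPair.one
  have hκ : κ ≫ eU.hom = j := by
    rw [← cancel_epi (cokernel.π z)]
    simp [κ, heU, fr]
  have : Mono (κ ≫ eU.hom) := by rwa [hκ]
  have : Mono (cokernel.map (homRow S).τ₁ (homRow S).τ₂ ((leftRow S).map T).f (rightRow S).f
      (homRow S).comm₁₂) := mono_of_mono κ eU.hom
  have hm₃ : Mono (homRow S).τ₃ := mono_τ₃_of_mono_cokernel_map (homRow S) hTl hr
  have hc := shortExact_cokernel (homRow S) hTl hr
  let eU' : cokernel S.X₃.hom ≅ U' := isoX₃OfShortExact hc hjS (Iso.refl _) eU (by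
    change κ ≫ eU.hom = 𝟙 _ ≫ j
    rw [hκ, Category.id_comp])
  exact ⟨S, hS, rfl, commaBiprod_mem T hU hD₁, hl₃, hm₃, U', hU', ⟨eU'.symm⟩⟩

end CommaClass

end Paper
/-- from Corollary 4.2: given complete hereditary cotorsion pairs
`(𝒞₁,𝒞₂)` in `𝒜` and `(𝒟₁,𝒟₂)` in `ℬ` with `T(𝒟₁ ∩ 𝒟₂) ⊆ 𝒞₁ ∩ 𝒞₂`, `T(𝒟₁) ⊆ 𝒞₁`
and `(LₙT)(𝒟₁) = 0` for `n ≥ 1`, the pair `(𝔅^{𝒞₁}_{𝒟₁}, 𝔅^{𝒞₁∩𝒞₂}_{𝒟₁∩𝒟₂})` is a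
left Frobenius pair in `(T ↓ 𝒜)`. -/
theorem statement11
    {𝒜 : Type u} [Category.{v} 𝒜] [Abelian 𝒜] [EnoughProjectives 𝒜] [EnoughInjectives 𝒜]
    {ℬ : Type u'} [Category.{v'} ℬ] [Abelian ℬ] [EnoughProjectives ℬ] [EnoughInjectives ℬ]
    (T : ℬ ⥤ 𝒜) [T.Additive] [PreservesFiniteColimits T]
    [Abelian (Comma T (𝟭 𝒜))]
    [HasExt.{w₁} 𝒜] [HasExt.{w₂} ℬ] [HasExt.{w₃} (Comma T (𝟭 𝒜))]
    (𝒞₁ 𝒞₂ : Set 𝒜) (𝒟₁ 𝒟₂ : Set ℬ)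
    (hC : IsCompleteHereditaryCotorsionPair 𝒞₁ 𝒞₂)
    (hD : IsCompleteHereditaryCotorsionPair 𝒟₁ 𝒟₂)
    (hT₁ : ∀ D ∈ 𝒟₁ ∩ 𝒟₂, T.obj D ∈ 𝒞₁ ∩ 𝒞₂)
    (hT₂ : ∀ D ∈ 𝒟₁, T.obj D ∈ 𝒞₁)
    (hLT : ∀ D ∈ 𝒟₁, ∀ n : ℕ, 1 ≤ n → IsZero ((T.leftDerived n).obj D)) :
    IsLeftFrobeniusPair (CommaClass T 𝒞₁ 𝒟₁) (CommaClass T (𝒞₁ ∩ 𝒞₂) (𝒟₁ ∩ 𝒟₂)) := by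
  have hT : ∀ S : ShortComplex ℬ, S.ShortExact → S.X₃ ∈ 𝒟₁ → (S.map T).ShortExact :=
    fun S hS h₃ ↦ shortExact_map_of_isZero_leftDerived T hS (hLT _ h₃ 1 le_rfl)
  exact
    { closed_extensions := fun S hS h₁ h₃ ↦
        commaClass_extension hC.toIsCotorsionPair hD.toIsCotorsionPair hT hS h₁ h₃
      closed_kernels_of_epis := fun S hS h₂ h₃ ↦ commaClass_kernel hC hD hT hS h₂ h₃
      closed_summands_X := fun C A B hZ ⟨e⟩ ↦
        commaClass_of_retract hC.left_of_retract hD.left_of_retract (retractOfIsoBiprod e) hZ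
      closed_summands_W := fun C A B hZ ⟨e⟩ ↦
        commaClass_of_retract (𝒳 := 𝒞₁ ∩ 𝒞₂) (𝒴 := 𝒟₁ ∩ 𝒟₂)
          (fun r h ↦ ⟨hC.left_of_retract r h.1, hC.right_of_retract r h.2⟩)
          (fun r h ↦ ⟨hD.left_of_retract r h.1, hD.right_of_retract r h.2⟩)
          (retractOfIsoBiprod e) hZ
      W_subset_X := fun _ ⟨hl, hm, V, hV, e⟩ ↦ ⟨hl.1, hm, V, hV.1, e⟩
      W_subset_rightPerp := fun W hW X hX i hi ↦ by
        obtain ⟨n, rfl⟩ := Nat.exists_eq_add_of_le' hi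
        exact subsingleton_ext_of_subsingleton_ext_one _ W
          (commaClass_exists_projective hC hD hT) (commaClass_ext_one hC hD hT hT₁ hT₂ hW) n X hX
      cogenerator := fun Z hZ ↦ commaClass_cogenerator hC.toIsCompleteCotorsionPair
        hD.toIsCompleteCotorsionPair hT hT₁ Z hZ }
end
end

section
/- Let 𝒜 and ℬ be abelian categories with enough projectives and injectives and T : ℬ → 𝒜 a right exact functor such that T(Q^•) is exact for every exact complex Q^• of projective objects in ℬ. Then (L_nT)(G) = 0 for every Gorenstein projective object G of ℬ and every n ≥ 1. -/
/-!
Formalization of a statement from "Recollements induced by left Frobenius pairs"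
(Ma, Sun, Zhu, Hu). Auxiliary definitions (left Frobenius pairs, the classes
`𝒳̂` and `𝔅^𝒳_𝒴`, etc.) are given first; the statement itself is the final theorem.
-/

noncomputable section
namespace Paper
open CategoryTheory CategoryTheory.Limits ZeroObject

universe w₁ w₂ w₃ v v' u u'

section GorensteinProjective
variable {𝒜 : Type u} [Category.{v} 𝒜] [Abelian 𝒜]

/-- The complex `Hom_𝒜(P^•, Q)` of abelian groups is exact. -/
def HomComplexExact (P : CochainComplex 𝒜 ℤ) (Q : 𝒜) : Prop :=
  ∀ n, ((((preadditiveYoneda.obj Q).mapHomologicalComplex _).obj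
    (HomologicalComplex.op P)).ExactAt n)

/-- `M` is a Gorenstein projective object: `M ≅ Z⁰(P^•)` for some acyclic complex `P^•`
of projective objects such that `Hom(P^•, Q)` is exact for every projective `Q`. -/
def IsGorensteinProjective (M : 𝒜) : Prop :=
  ∃ P : CochainComplex 𝒜 ℤ,
    (∀ n, Projective (P.X n)) ∧ (∀ n, P.ExactAt n) ∧
    (∀ Q : 𝒜, Projective Q → HomComplexExact P Q) ∧
    Nonempty (M ≅ P.cycles 0)

/-- A complete projective resolution: an acyclic complex of projective objects which stays
exact after applying `Hom(-, Q)` for every projective `Q`. -/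
def IsCompleteProjectiveResolution (P : CochainComplex 𝒜 ℤ) : Prop :=
  (∀ n, Projective (P.X n)) ∧ (∀ n, P.ExactAt n) ∧
    ∀ Q : 𝒜, Projective Q → HomComplexExact P Q

variable {ℬ : Type u'} [Category.{v'} ℬ] [Abelian ℬ]

/-- Condition (C1): `T` sends exact complexes of projective objects to exact complexes. -/
def CompatibleC1 (T : ℬ ⥤ 𝒜) [T.Additive] : Prop :=
  ∀ Q : CochainComplex ℬ ℤ, (∀ n, Projective (Q.X n)) → (∀ n, Q.ExactAt n) →
    ∀ n, ((T.mapHomologicalComplex _).obj Q).ExactAt n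

/-- Condition (C2): `Hom_𝒜(P^•, T Q)` is exact for every complete `𝒜`-projective
resolution `P^•` and every projective object `Q` of `ℬ`. -/
def CompatibleC2 (T : ℬ ⥤ 𝒜) : Prop :=
  ∀ P : CochainComplex 𝒜 ℤ, IsCompleteProjectiveResolution P →
    ∀ Q : ℬ, Projective Q → HomComplexExact P (T.obj Q)

/-- `T` is a compatible functor. -/
def Compatible (T : ℬ ⥤ 𝒜) [T.Additive] : Prop := CompatibleC1 T ∧ CompatibleC2 T

end GorensteinProjective

end Paper

open CategoryTheory CategoryTheory.Limits ZeroObject Paper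

universe w₁ w₂ w₃ v v' u u'

/-- The restriction of an exact cochain complex to degrees `≤ p` is exact in degrees `< p`. -/
lemma exactAt_restriction_embeddingUpIntLE {C : Type u} [Category.{v} C] [Abelian C]
    (K : CochainComplex C ℤ) (hK : ∀ n, K.ExactAt n) (p : ℤ) (n : ℕ) :
    (K.restriction (ComplexShape.embeddingUpIntLE p)).ExactAt (n + 1) := by
  rw [HomologicalComplex.exactAt_iff_isZero_homology]
  refine IsZero.of_iso ?_ (K.restrictionHomologyIso (ComplexShape.embeddingUpIntLE p)
    (n + 1 + 1) (n + 1) n (by simp) (by simp)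
    (i' := p - (n + 1 + 1 : ℕ)) (j' := p - (n + 1 : ℕ)) (k' := p - n) rfl rfl rfl
    (by simp; ring) (by simp; ring))
  exact (HomologicalComplex.exactAt_iff_isZero_homology _ _).1 (hK _)

/-- If a complex is exact in degree `j`, then its boundary map onto the cycles in degree `j` is
an epimorphism. -/
lemma epi_toCycles_of_exactAt {C : Type u} [Category.{v} C] [Abelian C] {ι : Type*}
    {c : ComplexShape ι} (K : HomologicalComplex C c) {i j : ι} (hi : c.prev j = i)
    (hK : K.ExactAt j) : Epi (K.toCycles i j) :=
  Preadditive.epi_of_isZero_cokernel' _ (K.homologyIsCokernel i j hi)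
    ((K.exactAt_iff_isZero_homology j).1 hK)

/-- If a complex is exact in degree `j`, then so is the sequence `K.X i ⟶ K.X j ⟶ K.cycles k`. -/
lemma exact_d_toCycles_of_exactAt {C : Type u} [Category.{v} C] [Abelian C] {ι : Type*}
    {c : ComplexShape ι} (K : HomologicalComplex C c) {i j k : ι} (hi : c.prev j = i)
    (hk : c.next j = k) (hK : K.ExactAt j) :
    (ShortComplex.mk (K.d i j) (K.toCycles j k) (K.d_toCycles i j k)).Exact := by
  let φ : ShortComplex.mk (K.d i j) (K.toCycles j k) (K.d_toCycles i j k) ⟶ K.sc' i j k :=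
    { τ₁ := 𝟙 (K.X i)
      τ₂ := 𝟙 (K.X j)
      τ₃ := K.iCycles k
      comm₁₂ := (Category.id_comp (K.d i j)).trans (Category.comp_id (K.d i j)).symm
      comm₂₃ := (Category.id_comp (K.d j k)).trans (K.toCycles_i j k).symm }
  have : Epi φ.τ₁ := inferInstanceAs (Epi (𝟙 _))
  have : IsIso φ.τ₂ := inferInstanceAs (IsIso (𝟙 _))
  have : Mono φ.τ₃ := inferInstanceAs (Mono (K.iCycles k))
  exact (ShortComplex.exact_iff_of_epi_of_isIso_of_mono φ).2 ((K.exactAt_iff' i j k hi hk).1 hK)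

/-- The brutal truncation of an exact complex of projectives `P` in degrees `≤ -1` is a
projective resolution of the cycles of `P` in degree `0`. -/
def projectiveResolutionCyclesZero {C : Type u} [Category.{v} C] [Abelian C]
    (P : CochainComplex C ℤ) (hP : ∀ n, Projective (P.X n)) (hE : ∀ n, P.ExactAt n) :
    ProjectiveResolution (P.cycles 0) where
  complex := P.restriction (ComplexShape.embeddingUpIntLE (-1))
  projective _ := hP _
  π := (ChainComplex.toSingle₀Equiv _ _).symm
    ⟨P.toCycles ((ComplexShape.embeddingUpIntLE (-1)).f 0) 0, P.d_toCycles _ _ _⟩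
  quasiIso := ⟨fun n => by
    cases n with
    | zero =>
      rw [ChainComplex.quasiIsoAt₀_iff, ShortComplex.quasiIso_iff_of_zeros']
      · refine (ShortComplex.exact_and_epi_g_iff_of_iso ?_).2
          ⟨exact_d_toCycles_of_exactAt P (i := (ComplexShape.embeddingUpIntLE (-1)).f 1)
            (j := (ComplexShape.embeddingUpIntLE (-1)).f 0) (k := 0) (by simp) (by simp) (hE _),
          epi_toCycles_of_exactAt P (by simp) (hE 0)⟩
        refine ShortComplex.isoMk (Iso.refl _) (Iso.refl _) (Iso.refl _) ?_ ?_
        · exact (Category.id_comp _).trans (Category.comp_id _).symm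
        · refine (Category.id_comp _).trans (Eq.trans ?_ (Category.comp_id _).symm)
          exact (ChainComplex.toSingle₀Equiv_symm_apply_f_zero (V := C)
            (C := P.restriction (ComplexShape.embeddingUpIntLE (-1)))
            (P.toCycles ((ComplexShape.embeddingUpIntLE (-1)).f 0) 0)
            (P.d_toCycles _ _ _)).symm
      · exact HomologicalComplex.shape _ _ _ (by simp)
      all_goals rfl
    | succ n =>
      rw [quasiIsoAt_iff_exactAt']
      · exact exactAt_restriction_embeddingUpIntLE P hE (-1) n
      · apply ChainComplex.exactAt_succ_single_obj⟩

/-- if `T` sends exact complexes of projectives to exact complexes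
(condition (C1)), then `(LₙT)(G) = 0` for every Gorenstein projective object `G` and
every `n ≥ 1`. -/
theorem statement17
    {𝒜 : Type u} [Category.{v} 𝒜] [Abelian 𝒜] [EnoughProjectives 𝒜] [EnoughInjectives 𝒜]
    {ℬ : Type u'} [Category.{v'} ℬ] [Abelian ℬ] [EnoughProjectives ℬ] [EnoughInjectives ℬ]
    (T : ℬ ⥤ 𝒜) [T.Additive] [PreservesFiniteColimits T]
    (hC1 : CompatibleC1 T)
    (G : ℬ) (hG : IsGorensteinProjective G)
    (n : ℕ) (hn : 1 ≤ n) :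
    IsZero ((T.leftDerived n).obj G) := by
  obtain ⟨P, hP, hE, -, ⟨e⟩⟩ := hG
  obtain ⟨n, rfl⟩ := Nat.exists_eq_add_of_le' hn
  refine IsZero.of_iso ?_ ((T.leftDerived (n + 1)).mapIso e ≪≫
    (projectiveResolutionCyclesZero P hP hE).isoLeftDerivedObj T (n + 1))
  exact (HomologicalComplex.exactAt_iff_isZero_homology _ _).1
    (exactAt_restriction_embeddingUpIntLE ((T.mapHomologicalComplex _).obj P)
      (hC1 P hP hE) (-1) n)
end
end
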